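/- Let T be a semistandard punctured tableau of shape (λ,H) and let (r,c) ∈ H be the latest slidable hole with respect to the lexicographic order. Then the row-word of T is Knuth equivalent to the row-word of Sl(T;r,c), the result of the Schützenberger sliding applied at (r,c). -/

import Mathlib

open scoped Classical

/-- A partition recorded by its parts `λ_i = f i` for `i ≥ 1`. -/
def IsPartitionF (f : ℕ → ℕ) : Prop :=
  (∀ i j, 1 ≤ i → i ≤ j → f j ≤ f i) ∧ ∃ N, ∀ i, N < i → f i = 0

/-- The Young diagram `D(λ)` of a partition. -/
def cells (f : ℕ → ℕ) : Set (ℕ × ℕ) := {p | 1 ≤ p.1 ∧ 1 ≤ p.2 ∧ p.2 ≤ f p.1}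

/-- A punctured tableau of shape `(λ,H)`, recorded as a function `T : ℕ×ℕ → ℕ` which
takes positive values exactly on `D(λ,H) = D(λ) \ H` (and `0` elsewhere). -/
def PTab (f : ℕ → ℕ) (H : Set (ℕ × ℕ)) (T : ℕ × ℕ → ℕ) : Prop :=
  (∀ p, p ∉ cells f \ H → T p = 0) ∧ (∀ p ∈ cells f \ H, 1 ≤ T p)

/-- A semistandard punctured tableau: entries weakly increase along rows and strictly
increase down columns (comparisons among filled cells). -/
def PSSYT (f : ℕ → ℕ) (H : Set (ℕ × ℕ)) (T : ℕ × ℕ → ℕ) : Prop :=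
  PTab f H T ∧
  (∀ i j l, (i, j) ∈ cells f \ H → (i, l) ∈ cells f \ H → j < l → T (i, j) ≤ T (i, l)) ∧
  (∀ i k j, (i, j) ∈ cells f \ H → (k, j) ∈ cells f \ H → i < k → T (i, j) < T (k, j))

/-- The row-word: entries read left-to-right along rows, bottom row to top, skipping
holes; `N` is any bound on the number of rows. -/
noncomputable def rowWordP (f : ℕ → ℕ) (H : Set (ℕ × ℕ)) (T : ℕ × ℕ → ℕ) (N : ℕ) :
    List ℕ :=
  ((List.range N).reverse.map (fun i =>
    ((((List.range (f (i + 1))).map (· + 1)).filter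
        (fun j => decide ((i + 1, j) ∉ H))).map (fun j => T (i + 1, j))))).flatten

/-- The column-word: entries of each column read bottom-to-top, columns left to right,
skipping holes; `N` bounds the number of rows, `M` the number of columns. -/
noncomputable def colWordP (f : ℕ → ℕ) (H : Set (ℕ × ℕ)) (T : ℕ × ℕ → ℕ) (N M : ℕ) :
    List ℕ :=
  ((List.range M).map (fun j =>
    ((((List.range N).reverse.map (· + 1)).filter
        (fun i => decide ((i, j + 1) ∈ cells f \ H))).map (fun i => T (i, j + 1))))).flatten

/-- Elementary Knuth transformations on three consecutive letters:
(K1) `yzx ↦ yxz` if `x < y ≤ z`; (K2) `xzy ↦ zxy` if `x ≤ y < z`. -/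
inductive KnuthStep : List ℕ → List ℕ → Prop
  | K1 (a b : List ℕ) (x y z : ℕ) (h1 : x < y) (h2 : y ≤ z) :
      KnuthStep (a ++ y :: z :: x :: b) (a ++ y :: x :: z :: b)
  | K2 (a b : List ℕ) (x y z : ℕ) (h1 : x ≤ y) (h2 : y < z) :
      KnuthStep (a ++ x :: z :: y :: b) (a ++ z :: x :: y :: b)

/-- Knuth equivalence of words. -/
def Knuth : List ℕ → List ℕ → Prop := Relation.EqvGen KnuthStep

/-- A hole `p ∈ H` is slidable if the cell to its right or below belongs to `D(λ,H)`. -/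
def Slidable (f : ℕ → ℕ) (H : Set (ℕ × ℕ)) (p : ℕ × ℕ) : Prop :=
  p ∈ H ∧ ((p.1, p.2 + 1) ∈ cells f \ H ∨ (p.1 + 1, p.2) ∈ cells f \ H)

/-- A hole `p ∈ H` is reversely slidable if the cell to its left or above belongs to
`D(λ,H)`. -/
def RevSlidable (f : ℕ → ℕ) (H : Set (ℕ × ℕ)) (p : ℕ × ℕ) : Prop :=
  p ∈ H ∧ ((p.1, p.2 - 1) ∈ cells f \ H ∨ (p.1 - 1, p.2) ∈ cells f \ H)

/-- Move the hole from `p` to the filled cell `q`: the entry at `q` moves into `p`, and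
`q` becomes the new hole (set to `0`). -/
noncomputable def moveHole (H : Set (ℕ × ℕ)) (T : ℕ × ℕ → ℕ) (p q : ℕ × ℕ) :
    Set (ℕ × ℕ) × (ℕ × ℕ → ℕ) :=
  ((H \ {p}) ∪ {q}, Function.update (Function.update T p (T q)) q 0)

/-- One step of the Schützenberger sliding: the state is `(H, T, hole)`.  The hole moves
right if the entry to the right is strictly smaller than the entry below (or there is no
entry below), and moves down otherwise (when there is an entry below). -/
def SlideStep (f : ℕ → ℕ) :
    (Set (ℕ × ℕ) × (ℕ × ℕ → ℕ) × (ℕ × ℕ)) → (Set (ℕ × ℕ) × (ℕ × ℕ → ℕ) × (ℕ × ℕ)) → Prop :=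
  fun s t =>
    ((s.2.2.1, s.2.2.2 + 1) ∈ cells f \ s.1 ∧
      ((s.2.2.1 + 1, s.2.2.2) ∈ cells f \ s.1 →
        s.2.1 (s.2.2.1, s.2.2.2 + 1) < s.2.1 (s.2.2.1 + 1, s.2.2.2)) ∧
      t = ((moveHole s.1 s.2.1 s.2.2 (s.2.2.1, s.2.2.2 + 1)).1,
           (moveHole s.1 s.2.1 s.2.2 (s.2.2.1, s.2.2.2 + 1)).2, (s.2.2.1, s.2.2.2 + 1)))
  ∨ ((s.2.2.1 + 1, s.2.2.2) ∈ cells f \ s.1 ∧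
      ((s.2.2.1, s.2.2.2 + 1) ∈ cells f \ s.1 →
        s.2.1 (s.2.2.1 + 1, s.2.2.2) ≤ s.2.1 (s.2.2.1, s.2.2.2 + 1)) ∧
      t = ((moveHole s.1 s.2.1 s.2.2 (s.2.2.1 + 1, s.2.2.2)).1,
           (moveHole s.1 s.2.1 s.2.2 (s.2.2.1 + 1, s.2.2.2)).2, (s.2.2.1 + 1, s.2.2.2)))

/-- One step of the reverse sliding: the hole moves left if the entry to the left is
strictly greater than the entry above (or there is no entry above), and moves up
otherwise (when there is an entry above). -/
def RevSlideStep (f : ℕ → ℕ) :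
    (Set (ℕ × ℕ) × (ℕ × ℕ → ℕ) × (ℕ × ℕ)) → (Set (ℕ × ℕ) × (ℕ × ℕ → ℕ) × (ℕ × ℕ)) → Prop :=
  fun s t =>
    ((s.2.2.1, s.2.2.2 - 1) ∈ cells f \ s.1 ∧
      ((s.2.2.1 - 1, s.2.2.2) ∈ cells f \ s.1 →
        s.2.1 (s.2.2.1 - 1, s.2.2.2) < s.2.1 (s.2.2.1, s.2.2.2 - 1)) ∧
      t = ((moveHole s.1 s.2.1 s.2.2 (s.2.2.1, s.2.2.2 - 1)).1,
           (moveHole s.1 s.2.1 s.2.2 (s.2.2.1, s.2.2.2 - 1)).2, (s.2.2.1, s.2.2.2 - 1)))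
  ∨ ((s.2.2.1 - 1, s.2.2.2) ∈ cells f \ s.1 ∧
      ((s.2.2.1, s.2.2.2 - 1) ∈ cells f \ s.1 →
        s.2.1 (s.2.2.1, s.2.2.2 - 1) ≤ s.2.1 (s.2.2.1 - 1, s.2.2.2)) ∧
      t = ((moveHole s.1 s.2.1 s.2.2 (s.2.2.1 - 1, s.2.2.2)).1,
           (moveHole s.1 s.2.1 s.2.2 (s.2.2.1 - 1, s.2.2.2)).2, (s.2.2.1 - 1, s.2.2.2)))

/-- `p` is the latest slidable hole with respect to the lexicographic order. -/
def LatestSlidable (f : ℕ → ℕ) (H : Set (ℕ × ℕ)) (p : ℕ × ℕ) : Prop :=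
  Slidable f H p ∧ ∀ q, Slidable f H q → q.1 < p.1 ∨ (q.1 = p.1 ∧ q.2 ≤ p.2)

/-- `p` is the first reversely slidable hole with respect to the lexicographic order. -/
def FirstRevSlidable (f : ℕ → ℕ) (H : Set (ℕ × ℕ)) (p : ℕ × ℕ) : Prop :=
  RevSlidable f H p ∧ ∀ q, RevSlidable f H q → p.1 < q.1 ∨ (p.1 = q.1 ∧ p.2 ≤ q.2)

/-- One step of the rectification: perform the full sliding `Sl(T;r,c)` at the latest
slidable hole `(r,c)`. -/
def RectStep (f : ℕ → ℕ) :
    (Set (ℕ × ℕ) × (ℕ × ℕ → ℕ)) → (Set (ℕ × ℕ) × (ℕ × ℕ → ℕ)) → Prop :=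
  fun s t => ∃ p p', LatestSlidable f s.1 p ∧
    Relation.ReflTransGen (SlideStep f) (s.1, s.2, p) (t.1, t.2, p') ∧
    ¬ Slidable f t.1 p'

/-- One step of the reverse rectification: perform the full reverse sliding at the first
reversely slidable hole. -/
def RevRectStep (f : ℕ → ℕ) :
    (Set (ℕ × ℕ) × (ℕ × ℕ → ℕ)) → (Set (ℕ × ℕ) × (ℕ × ℕ → ℕ)) → Prop :=
  fun s t => ∃ p p', FirstRevSlidable f s.1 p ∧
    Relation.ReflTransGen (RevSlideStep f) (s.1, s.2, p) (t.1, t.2, p') ∧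
    ¬ RevSlidable f t.1 p'

namespace Knuth

theorem refl (a : List ℕ) : Knuth a a := Relation.EqvGen.refl a

theorem symm {a b : List ℕ} (h : Knuth a b) : Knuth b a := Relation.EqvGen.symm _ _ h

theorem trans {a b c : List ℕ} (h : Knuth a b) (h' : Knuth b c) : Knuth a c :=
  Relation.EqvGen.trans _ _ _ h h'

theorem append_append {a b : List ℕ} (h : Knuth a b) (s t : List ℕ) :
    Knuth (s ++ a ++ t) (s ++ b ++ t) := by
  induction h with
  | rel a b h =>
    apply Relation.EqvGen.rel
    cases h with
    | K1 a b x y z h1 h2 =>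
      simpa using KnuthStep.K1 (s ++ a) (b ++ t) x y z h1 h2
    | K2 a b x y z h1 h2 =>
      simpa using KnuthStep.K2 (s ++ a) (b ++ t) x y z h1 h2
  | refl a => exact refl _
  | symm a b _ ih => exact ih.symm
  | trans a b c _ _ ih ih' => exact ih.trans ih'

theorem append_left {a b : List ℕ} (h : Knuth a b) (s : List ℕ) : Knuth (s ++ a) (s ++ b) := by
  simpa using h.append_append s []

theorem append_right {a b : List ℕ} (h : Knuth a b) (t : List ℕ) : Knuth (a ++ t) (b ++ t) := by
  simpa using h.append_append [] t

/-- A letter smaller than `z` moves left across a row whose letters are at least `z`. -/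
theorem move_small_left {y z : ℕ} (hyz : y < z) (Z : List ℕ) (hZ : Z.Pairwise (· ≤ ·))
    (hz : ∀ a ∈ Z, z ≤ a) : Knuth (z :: Z ++ [y]) (z :: y :: Z) := by
  induction Z generalizing z with
  | nil => exact refl _
  | cons a Z ih =>
    rw [List.pairwise_cons] at hZ
    have ha : z ≤ a := hz a (by simp)
    have h₁ := (ih (hyz.trans_le ha) hZ.2 hZ.1).append_left [z]
    have h₂ : Knuth (z :: a :: y :: Z) (z :: y :: a :: Z) :=
      Relation.EqvGen.rel _ _ (KnuthStep.K1 [] Z y z a hyz ha)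
    exact trans (by simpa using h₁) h₂

/-- A letter larger than `y` moves left across a row whose letters are at most `y`. -/
theorem move_large_left {y z : ℕ} (hyz : y < z) (R : List ℕ) (hR : R.Pairwise (· ≤ ·))
    (hy : ∀ a ∈ R, a ≤ y) : Knuth (R ++ [z, y]) (z :: R ++ [y]) := by
  induction R using List.reverseRecOn generalizing y with
  | nil => exact refl _
  | append_singleton R a ih =>
    rw [List.pairwise_append] at hR
    have ha : a ≤ y := hy a (by simp)
    have h₁ : Knuth (R ++ [a, z, y]) (R ++ [z, a, y]) :=
      Relation.EqvGen.rel _ _ (KnuthStep.K2 R [] a y z ha hyz)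
    have h₂ := (ih (ha.trans_lt hyz) hR.1 (fun b hb => hR.2.2 b hb a (by simp))).append_right [y]
    exact trans (by simpa using h₁) (by simpa using h₂)

/-- Row insertion of `y` into the row `R z Z`, bumping `z`. -/
theorem row_insert {y z : ℕ} (hyz : y < z) (R Z : List ℕ) (hR : R.Pairwise (· ≤ ·))
    (hy : ∀ a ∈ R, a ≤ y) (hZ : Z.Pairwise (· ≤ ·)) (hz : ∀ a ∈ Z, z ≤ a) :
    Knuth (R ++ z :: Z ++ [y]) (z :: R ++ y :: Z) := by
  have h₁ := (move_small_left hyz Z hZ hz).append_left R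
  have h₂ := (move_large_left hyz R hR hy).append_right Z
  exact trans (by simpa using h₁) (by simpa using h₂)

end Knuth

/-- The letters `g j` for the indices `j` in `L` satisfying `q`. -/
noncomputable def subword (q : ℕ → Prop) (g : ℕ → ℕ) (L : List ℕ) : List ℕ :=
  (L.filter (fun j => decide (q j))).map g

theorem subword_append (q : ℕ → Prop) (g : ℕ → ℕ) (L L' : List ℕ) :
    subword q g (L ++ L') = subword q g L ++ subword q g L' := by
  simp [subword]

theorem subword_cons_of_pos {q : ℕ → Prop} {a : ℕ} (h : q a) (g : ℕ → ℕ) (L : List ℕ) :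
    subword q g (a :: L) = g a :: subword q g L := by
  simp [subword, h]

theorem subword_cons_of_neg {q : ℕ → Prop} {a : ℕ} (h : ¬ q a) (g : ℕ → ℕ) (L : List ℕ) :
    subword q g (a :: L) = subword q g L := by
  simp [subword, h]

theorem subword_congr {q q' : ℕ → Prop} {g g' : ℕ → ℕ} {L : List ℕ}
    (hq : ∀ a ∈ L, q a ↔ q' a) (hg : ∀ a ∈ L, q a → g a = g' a) :
    subword q g L = subword q' g' L := by
  unfold subword
  rw [← List.filter_congr (fun a ha => decide_eq_decide.2 (hq a ha))]
  apply List.map_congr_left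
  intro a ha
  rw [List.mem_filter] at ha
  exact hg a ha.1 (by simpa using ha.2)

theorem subword_eq_nil {q : ℕ → Prop} {L : List ℕ} (h : ∀ a ∈ L, ¬ q a) (g : ℕ → ℕ) :
    subword q g L = [] := by
  simpa [subword] using h

theorem mem_subword {q : ℕ → Prop} {g : ℕ → ℕ} {L : List ℕ} {x : ℕ} :
    x ∈ subword q g L ↔ ∃ a ∈ L, q a ∧ g a = x := by
  simp [subword, and_assoc]

theorem subword_pairwise {q : ℕ → Prop} {g : ℕ → ℕ} {L : List ℕ} (hL : L.Pairwise (· < ·))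
    (hg : ∀ a ∈ L, ∀ b ∈ L, q a → q b → a < b → g a ≤ g b) :
    (subword q g L).Pairwise (· ≤ ·) := by
  unfold subword
  rw [List.pairwise_map]
  refine List.Pairwise.imp_of_mem ?_ (hL.sublist List.filter_sublist)
  intro a b ha hb hab
  rw [List.mem_filter, decide_eq_true_iff] at ha hb
  exact hg a ha.1 b hb.1 ha.2 hb.2 hab

/-- Inserting a row of letters `u` into a row `R Z`, where the letters of `Z` lie in the columns
of an initial segment of those of `u` and dominate them, bumps exactly `Z`. -/
theorem knuth_bump_right (u v : ℕ → ℕ) (qu qv : ℕ → Prop) (L : List ℕ) (R : List ℕ)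
    (hL : L.Pairwise (· < ·))
    (hdown : ∀ a ∈ L, ∀ b ∈ L, a < b → qv b → qv a)
    (huv : ∀ a ∈ L, qv a → qu a ∧ u a < v a)
    (hv : ∀ a ∈ L, ∀ b ∈ L, qv a → qv b → a < b → v a ≤ v b)
    (hu : ∀ a ∈ L, ∀ b ∈ L, qu a → qu b → a < b → u a ≤ u b)
    (hR : R.Pairwise (· ≤ ·)) (hRu : ∀ x ∈ R, ∀ a ∈ L, qu a → x ≤ u a) :
    Knuth (R ++ subword qv v L ++ subword qu u L) (subword qv v L ++ R ++ subword qu u L) := by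
  induction L generalizing R with
  | nil => simpa [subword] using Knuth.refl R
  | cons a L ih =>
    rw [List.pairwise_cons] at hL
    by_cases ha : qv a
    · obtain ⟨hua, hlt⟩ := huv a (by simp) ha
      rw [subword_cons_of_pos ha, subword_cons_of_pos hua]
      have h₁ := (Knuth.row_insert hlt R (subword qv v L) hR
        (fun x hx => hRu x hx a (by simp) hua)
        (subword_pairwise hL.2 fun b hb c hc => hv b (by simp [hb]) c (by simp [hc]))
        (by
          intro x hx
          obtain ⟨b, hb, hqb, rfl⟩ := mem_subword.1 hx
          exact hv a (by simp) b (by simp [hb]) ha hqb (hL.1 b hb))).append_right (subword qu u L)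
      have h₂ := (ih (R ++ [u a]) hL.2
        (fun b hb c hc => hdown b (by simp [hb]) c (by simp [hc]))
        (fun b hb => huv b (by simp [hb]))
        (fun b hb c hc => hv b (by simp [hb]) c (by simp [hc]))
        (fun b hb c hc => hu b (by simp [hb]) c (by simp [hc]))
        (by
          rw [List.pairwise_append]
          refine ⟨hR, by simp, fun x hx y hy => ?_⟩
          obtain rfl : y = u a := by simpa using hy
          exact hRu x hx a (by simp) hua)
        (by
          intro x hx b hb hqb
          rcases List.mem_append.1 hx with hx | hx
          · exact hRu x hx b (by simp [hb]) hqb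
          · obtain rfl : x = u a := by simpa using hx
            exact hu a (by simp) b (by simp [hb]) hua hqb (hL.1 b hb))).append_left [v a]
      exact Knuth.trans (by simpa using h₁) (by simpa using h₂)
    · rw [subword_eq_nil (q := qv)]
      · simpa using Knuth.refl _
      · intro b hb hqb
        rcases List.mem_cons.1 hb with rfl | hb'
        · exact ha hqb
        · exact ha (hdown a (by simp) b hb (hL.1 b hb') hqb)

/-- Inserting a row of letters `u` into a row `V Z`, where the letters of `V` occupy all the
columns of `u` and dominate them, bumps only letters of `V`. -/
theorem knuth_bump_left (u v : ℕ → ℕ) (qu qv : ℕ → Prop) (n : ℕ) (Z : List ℕ)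
    (huv : ∀ a < n, qu a → qv a ∧ u a < v a)
    (hv : ∀ a b, b < n → qv a → qv b → a < b → v a ≤ v b)
    (hu : ∀ a b, b < n → qu a → qu b → a < b → u a ≤ u b)
    (hZ : Z.Pairwise (· ≤ ·)) (hvZ : ∀ a < n, qv a → ∀ z ∈ Z, v a ≤ z) :
    Knuth (subword qv v (List.range n) ++ Z ++ subword qu u (List.range n))
      (subword qv v (List.range n) ++ subword qu u (List.range n) ++ Z) := by
  induction n generalizing Z with
  | zero => simpa [subword] using Knuth.refl Z
  | succ n ih =>
    have ih' := fun Z => ih Z (fun a ha => huv a (by omega)) (fun a b hb => hv a b (by omega))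
      (fun a b hb => hu a b (by omega))
    simp only [List.range_succ, subword_append]
    by_cases hn : qv n
    · rw [subword_cons_of_pos hn, subword_eq_nil (L := []) (by simp)]
      have h₁ := ih' (v n :: Z) (by
          rw [List.pairwise_cons]
          exact ⟨hvZ n (by omega) hn, hZ⟩) (by
          intro a ha hqa z hz
          rcases List.mem_cons.1 hz with rfl | hz
          · exact hv a n (by omega) hqa hn ha
          · exact hvZ a (by omega) hqa z hz)
      by_cases hun : qu n
      · rw [subword_cons_of_pos hun, subword_eq_nil (L := []) (by simp)]
        have h₂ := (Knuth.row_insert (huv n (by omega) hun).2 (subword qu u (List.range n)) Z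
          (subword_pairwise List.pairwise_lt_range
            (fun a ha b hb => hu a b (by have := List.mem_range.1 hb; omega)))
          (by
            intro x hx
            obtain ⟨a, ha, hqa, rfl⟩ := mem_subword.1 hx
            exact hu a n (by omega) hqa hun (List.mem_range.1 ha))
          hZ (hvZ n (by omega) hn)).append_left (subword qv v (List.range n))
        exact Knuth.trans (by simpa using h₁.append_right [u n]) (by simpa using h₂)
      · rw [subword_cons_of_neg hun, subword_eq_nil (L := []) (by simp)]
        have h₂ := (ih' [v n] (by simp) (by
          intro a ha hqa z hz
          obtain rfl : z = v n := by simpa using hz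
          exact hv a n (by omega) hqa hn ha)).append_right Z
        exact Knuth.trans (by simpa using h₁) (by simpa using h₂.symm)
    · have hun : ¬ qu n := fun h => hn (huv n (by omega) h).1
      rw [subword_cons_of_neg hn, subword_cons_of_neg hun, subword_eq_nil (L := []) (by simp),
        subword_eq_nil (L := []) (by simp)]
      simpa using ih' Z hZ fun a ha => hvZ a (by omega)

/-- The word of row `k`, read over the columns below `M`. -/
noncomputable def rowWord (f : ℕ → ℕ) (H : Set (ℕ × ℕ)) (T : ℕ × ℕ → ℕ) (M k : ℕ) : List ℕ :=
  subword (fun j => (k, j) ∈ cells f \ H) (fun j => T (k, j)) (List.range M)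

theorem rowWordP_eq (f : ℕ → ℕ) (H : Set (ℕ × ℕ)) (T : ℕ × ℕ → ℕ) (N M : ℕ)
    (hM : ∀ k, 1 ≤ k → f k < M) :
    rowWordP f H T N =
      ((List.range N).reverse.map (fun i => rowWord f H T M (i + 1))).flatten := by
  unfold rowWordP
  congr 1
  apply List.map_congr_left
  intro i _
  obtain ⟨e, he⟩ := Nat.exists_eq_add_of_lt (hM (i + 1) (by omega))
  have hrange : List.range M =
      0 :: (List.range (f (i + 1))).map (· + 1) ++
        (List.range e).map (fun x => f (i + 1) + 1 + x) := by
    rw [he, show f (i + 1) + e + 1 = f (i + 1) + 1 + e by omega, List.range_add,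
      List.range_succ_eq_map]
  unfold rowWord
  rw [hrange, subword_append, subword_cons_of_neg (by simp [cells]),
    subword_eq_nil (L := (List.range e).map _), List.append_nil]
  · unfold subword
    congr 1
    apply List.filter_congr
    intro j hj
    rw [decide_eq_decide]
    simp only [List.mem_map, List.mem_range] at hj
    obtain ⟨a, ha, rfl⟩ := hj
    simp [cells]
    omega
  · simp [cells]
    intros
    omega

/-- The filling is semistandard in the rows weakly below the hole `p`, and no slidable hole comes
after `p`. -/
structure SlideInv (f : ℕ → ℕ) (H : Set (ℕ × ℕ)) (T : ℕ × ℕ → ℕ) (p : ℕ × ℕ) : Prop where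
  sub : H ⊆ cells f
  mem : p ∈ H
  latest : ∀ q, Slidable f H q → q.1 < p.1 ∨ (q.1 = p.1 ∧ q.2 ≤ p.2)
  row : ∀ i j l, p.1 ≤ i → (i, j) ∈ cells f \ H → (i, l) ∈ cells f \ H → j < l →
    T (i, j) ≤ T (i, l)
  col : ∀ i k j, p.1 ≤ i → (i, j) ∈ cells f \ H → (k, j) ∈ cells f \ H → i < k →
    T (i, j) < T (k, j)

theorem mem_cells_of_le {f : ℕ → ℕ} (hf : IsPartitionF f) {i j k l : ℕ} (h : (k, l) ∈ cells f)
    (hi : 1 ≤ i) (hik : i ≤ k) (hj : 1 ≤ j) (hjl : j ≤ l) : (i, j) ∈ cells f := by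
  have := hf.1 i k hi hik
  simp only [cells, Set.mem_ofPred_eq] at h ⊢
  omega

theorem filled_moveHole {f : ℕ → ℕ} {H : Set (ℕ × ℕ)} {T : ℕ × ℕ → ℕ} {p q : ℕ × ℕ}
    (hp : p ∈ cells f) (hpq : p ≠ q) (x : ℕ × ℕ) :
    x ∈ cells f \ (moveHole H T p q).1 ↔ x ≠ q ∧ (x = p ∨ x ∈ cells f \ H) := by
  simp only [moveHole, Set.mem_sdiff, Set.mem_union, Set.mem_singleton_iff]
  by_cases h : x = p
  · subst h; simp [hp, hpq]
  · by_cases h' : x = q <;> simp [h, h']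

theorem moveHole_apply (H : Set (ℕ × ℕ)) (T : ℕ × ℕ → ℕ) {p q : ℕ × ℕ}
    {x : ℕ × ℕ} (hx : x ≠ q) :
    (moveHole H T p q).2 x = if x = p then T q else T x := by
  simp [moveHole, Function.update_apply, hx]

namespace SlideInv

variable {f : ℕ → ℕ} {H : Set (ℕ × ℕ)} {T : ℕ × ℕ → ℕ} {r c : ℕ}

theorem filled_above (hf : IsPartitionF f) (h : SlideInv f H T (r, c)) {k j : ℕ}
    (hk : (k + 1, j) ∈ cells f \ H) (hlt : r < k ∨ (r = k ∧ c < j)) :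
    (k, j) ∈ cells f \ H := by
  have h1 : 1 ≤ r := (h.sub h.mem).1
  have hc : (k, j) ∈ cells f :=
    mem_cells_of_le hf hk.1 (by omega) (by omega) hk.1.2.1 le_rfl
  refine ⟨hc, fun hH => ?_⟩
  have := h.latest (k, j) ⟨hH, Or.inr hk⟩
  simp only at this
  omega

theorem filled_left (hf : IsPartitionF f) (h : SlideInv f H T (r, c)) {k j : ℕ}
    (hj : 1 ≤ j) (hk : (k, j + 1) ∈ cells f \ H) (hlt : r < k ∨ (r = k ∧ c < j)) :
    (k, j) ∈ cells f \ H := by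
  have h1 : 1 ≤ r := (h.sub h.mem).1
  have hc : (k, j) ∈ cells f :=
    mem_cells_of_le hf hk.1 (by omega) le_rfl hj (by omega)
  refine ⟨hc, fun hH => ?_⟩
  have := h.latest (k, j) ⟨hH, Or.inl hk⟩
  simp only at this
  omega

theorem filled_above_le (hf : IsPartitionF f) (h : SlideInv f H T (r, c)) {i k j : ℕ}
    (hi : r < i) (hik : i ≤ k) (hk : (k, j) ∈ cells f \ H) : (i, j) ∈ cells f \ H := by
  induction k, hik using Nat.le_induction with
  | base => exact hk
  | succ k hik ih => exact ih (h.filled_above hf hk (by omega))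

theorem filled_left_le (hf : IsPartitionF f) (h : SlideInv f H T (r, c)) {k j l : ℕ}
    (hj : 1 ≤ j) (hlt : r < k ∨ (r = k ∧ c < j)) (hjl : j ≤ l) (hk : (k, l) ∈ cells f \ H) :
    (k, j) ∈ cells f \ H := by
  induction l, hjl using Nat.le_induction with
  | base => exact hk
  | succ l hjl ih => exact ih (h.filled_left hf (by omega) hk (by omega))

theorem latest_moveHole (h : SlideInv f H T (r, c)) {s d : ℕ}
    (hsd : (s = r ∧ d = c + 1) ∨ (s = r + 1 ∧ d = c)) (q : ℕ × ℕ)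
    (hq : Slidable f (moveHole H T (r, c) (s, d)).1 q) : q.1 < s ∨ (q.1 = s ∧ q.2 ≤ d) := by
  have hpq : (r, c) ≠ (s, d) := by simp; omega
  obtain ⟨a, b⟩ := q
  unfold Slidable at hq
  rw [filled_moveHole (h.sub h.mem) hpq, filled_moveHole (h.sub h.mem) hpq] at hq
  obtain ⟨hm, hq⟩ := hq
  simp only [moveHole, Set.mem_union, Set.mem_sdiff, Set.mem_singleton_iff, Prod.mk.injEq] at hm hq
  rcases hm with hm | hm
  · by_cases hs : Slidable f H (a, b)
    · have := h.latest _ hs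
      simp only at this ⊢
      omega
    · unfold Slidable at hs
      simp only [Set.mem_sdiff] at hs hq
      have : (a = r ∧ b + 1 = c) ∨ (a + 1 = r ∧ b = c) := by tauto
      omega
  · omega

theorem moveHole_sub (h : SlideInv f H T (r, c)) {q : ℕ × ℕ} (hq : q ∈ cells f) :
    (moveHole H T (r, c) q).1 ⊆ cells f := by
  rintro x (hx | rfl)
  · exact h.sub hx.1
  · exact hq

theorem moveRight (hf : IsPartitionF f) (h : SlideInv f H T (r, c))
    (hr : (r, c + 1) ∈ cells f \ H)
    (hd : (r + 1, c) ∈ cells f \ H → T (r, c + 1) < T (r + 1, c)) :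
    SlideInv f (moveHole H T (r, c) (r, c + 1)).1 (moveHole H T (r, c) (r, c + 1)).2
      (r, c + 1) := by
  have hpq : (r, c) ≠ (r, c + 1) := by simp
  refine ⟨h.moveHole_sub hr.1, Or.inr rfl, h.latest_moveHole (by omega), ?_, ?_⟩
  · intro i j l hi hj hl hjl
    rw [filled_moveHole (h.sub h.mem) hpq] at hj hl
    rw [moveHole_apply _ _ hj.1, moveHole_apply _ _ hl.1]
    obtain ⟨hj₁, hj₂⟩ := hj
    obtain ⟨hl₁, hl₂⟩ := hl
    simp only [ne_eq, Prod.mk.injEq] at hj₁ hj₂ hl₁ hl₂ hi ⊢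
    split_ifs with h1 h2 h2
    · exact le_rfl
    · obtain ⟨rfl, rfl⟩ := h1
      exact h.row _ _ _ le_rfl hr (hl₂.resolve_left h2) (by omega)
    · obtain ⟨rfl, rfl⟩ := h2
      exact h.row _ _ _ le_rfl (hj₂.resolve_left h1) hr (by omega)
    · exact h.row _ _ _ hi (hj₂.resolve_left h1) (hl₂.resolve_left h2) hjl
  · intro i k j hi hj hk hik
    rw [filled_moveHole (h.sub h.mem) hpq] at hj hk
    rw [moveHole_apply _ _ hj.1, moveHole_apply _ _ hk.1]
    obtain ⟨hj₁, hj₂⟩ := hj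
    obtain ⟨hk₁, hk₂⟩ := hk
    simp only [ne_eq, Prod.mk.injEq] at hj₁ hj₂ hk₁ hk₂ hi ⊢
    rw [if_neg (by omega : ¬ (k = r ∧ j = c))]
    have hk₃ := hk₂.resolve_left (by omega)
    split_ifs with h1
    · obtain ⟨rfl, rfl⟩ := h1
      have hb := h.filled_above_le hf (Nat.lt_succ_self _) hik hk₃
      rcases Nat.eq_or_lt_of_le hik with rfl | hlt
      · exact hd hk₃
      · exact (hd hb).trans (h.col _ _ _ (by simp) hb hk₃ hlt)
    · exact h.col _ _ _ hi (hj₂.resolve_left h1) hk₃ hik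

theorem moveDown (h : SlideInv f H T (r, c)) (hd : (r + 1, c) ∈ cells f \ H) :
    SlideInv f (moveHole H T (r, c) (r + 1, c)).1 (moveHole H T (r, c) (r + 1, c)).2
      (r + 1, c) := by
  have hpq : (r, c) ≠ (r + 1, c) := by simp
  refine ⟨h.moveHole_sub hd.1, Or.inr rfl, h.latest_moveHole (by omega), ?_, ?_⟩
  all_goals
    intro i j l hi hj hl hjl
    rw [filled_moveHole (h.sub h.mem) hpq] at hj hl
    rw [moveHole_apply _ _ hj.1, moveHole_apply _ _ hl.1]
    simp only [Prod.mk.injEq] at hi hj hl ⊢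
    rw [if_neg (by omega), if_neg (by omega)]
  · exact h.row _ _ _ (by simp only; omega) (hj.2.resolve_left (by omega))
      (hl.2.resolve_left (by omega)) hjl
  · exact h.col _ _ _ (by simp only; omega) (hj.2.resolve_left (by omega))
      (hl.2.resolve_left (by omega)) hjl

theorem rowWord_moveHole_of_ne (h : SlideInv f H T (r, c)) {s d M k : ℕ}
    (hpq : (r, c) ≠ (s, d)) (hr : k ≠ r) (hs : k ≠ s) :
    rowWord f (moveHole H T (r, c) (s, d)).1 (moveHole H T (r, c) (s, d)).2 M k =
      rowWord f H T M k := by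
  apply subword_congr
  · intro j _
    rw [filled_moveHole (h.sub h.mem) hpq]
    simp [hr, hs]
  · intro j _ _
    rw [moveHole_apply _ _ (by simp [hs])]
    simp [hr]

end SlideInv

theorem range_eq_append_cons {c M : ℕ} (h : c < M) :
    ∃ L, List.range M = List.range c ++ c :: L ∧ L.Pairwise (· < ·) ∧ ∀ a ∈ L, c < a := by
  obtain ⟨e, rfl⟩ := Nat.exists_eq_add_of_lt h
  refine ⟨(List.range e).map (fun x => c + 1 + x), ?_, ?_, ?_⟩
  · rw [show c + e + 1 = c + 1 + e by omega, List.range_add, List.range_succ]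
    simp
  · rw [List.pairwise_map]
    exact List.pairwise_lt_range.imp (by intros; omega)
  · intro a ha
    obtain ⟨x, -, rfl⟩ := List.mem_map.1 ha
    omega

namespace SlideInv

variable {f : ℕ → ℕ} {H : Set (ℕ × ℕ)} {T : ℕ × ℕ → ℕ} {r c : ℕ}

theorem rowWord_moveRight (h : SlideInv f H T (r, c)) {M : ℕ}
    (hM : ∀ k, 1 ≤ k → f k < M) (hr : (r, c + 1) ∈ cells f \ H) (k : ℕ) :
    rowWord f (moveHole H T (r, c) (r, c + 1)).1 (moveHole H T (r, c) (r, c + 1)).2 M k =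
      rowWord f H T M k := by
  have hpq : (r, c) ≠ (r, c + 1) := by simp
  rcases ne_or_eq k r with hk | rfl
  · exact h.rowWord_moveHole_of_ne hpq hk hk
  have hcM : c + 1 < M := hr.1.2.2.trans_lt (hM _ hr.1.1)
  obtain ⟨L, hL, -, hlt⟩ := range_eq_append_cons hcM
  unfold rowWord
  rw [hL, List.range_succ]
  simp only [subword_append]
  rw [subword_cons_of_pos (a := c), subword_cons_of_neg (a := c + 1),
    subword_cons_of_neg (a := c), subword_cons_of_pos (a := c + 1) hr,
    subword_eq_nil (L := []) (by simp), subword_eq_nil (L := []) (by simp),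
    moveHole_apply _ _ hpq, if_pos rfl]
  · simp only [List.append_nil, List.append_assoc, List.singleton_append]
    congr 1
    · apply subword_congr
      · intro j hj
        rw [List.mem_range] at hj
        rw [filled_moveHole (h.sub h.mem) hpq]
        simp only [ne_eq, Prod.mk.injEq]
        exact ⟨fun hq => hq.2.resolve_left (by omega), fun hq => ⟨by omega, Or.inr hq⟩⟩
      · intro j hj _
        rw [List.mem_range] at hj
        rw [moveHole_apply _ _ (by simp; omega), if_neg (by simp; omega)]
    · congr 1
      apply subword_congr
      · intro j hj
        have := hlt j hj
        rw [filled_moveHole (h.sub h.mem) hpq]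
        simp only [ne_eq, Prod.mk.injEq]
        exact ⟨fun hq => hq.2.resolve_left (by omega), fun hq => ⟨by omega, Or.inr hq⟩⟩
      · intro j hj _
        have := hlt j hj
        rw [moveHole_apply _ _ (by simp; omega), if_neg (by simp; omega)]
  · exact fun hc => hc.2 h.mem
  · rw [filled_moveHole (h.sub h.mem) hpq]; simp
  · rw [filled_moveHole (h.sub h.mem) hpq]; simp

theorem knuth_rows_moveDown (hf : IsPartitionF f) (h : SlideInv f H T (r, c)) {M : ℕ}
    (hM : ∀ k, 1 ≤ k → f k < M) (hd : (r + 1, c) ∈ cells f \ H)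
    (hr : (r, c + 1) ∈ cells f \ H → T (r + 1, c) ≤ T (r, c + 1)) :
    Knuth (rowWord f H T M (r + 1) ++ rowWord f H T M r)
      (rowWord f (moveHole H T (r, c) (r + 1, c)).1 (moveHole H T (r, c) (r + 1, c)).2 M (r + 1) ++
        rowWord f (moveHole H T (r, c) (r + 1, c)).1 (moveHole H T (r, c) (r + 1, c)).2 M r) := by
  have hpq : (r, c) ≠ (r + 1, c) := by simp
  have hcM : c < M := hd.1.2.2.trans_lt (hM _ hd.1.1)
  obtain ⟨L, hL, hLp, hlt⟩ := range_eq_append_cons hcM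
  have key : ∀ L' : List ℕ, c ∉ L' → ∀ k,
      subword (fun j => (k, j) ∈ cells f \ (moveHole H T (r, c) (r + 1, c)).1)
        (fun j => (moveHole H T (r, c) (r + 1, c)).2 (k, j)) L' =
      subword (fun j => (k, j) ∈ cells f \ H) (fun j => T (k, j)) L' := by
    intro L' hL' k
    apply subword_congr
    · intro j hj
      have hjc : j ≠ c := fun e => hL' (e ▸ hj)
      rw [filled_moveHole (h.sub h.mem) hpq]
      simp [hjc]
    · intro j hj _
      have hjc : j ≠ c := fun e => hL' (e ▸ hj)
      rw [moveHole_apply _ _ (by simp [hjc]), if_neg (by simp [hjc])]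
  have hcL : c ∉ L := fun hc => (hlt c hc).false
  unfold rowWord
  rw [hL]
  simp only [subword_append]
  rw [subword_cons_of_pos (q := fun j => (r + 1, j) ∈ cells f \ H) hd,
    subword_cons_of_neg (q := fun j => (r, j) ∈ cells f \ H) (fun hc => hc.2 h.mem),
    subword_cons_of_neg
      (q := fun j => (r + 1, j) ∈ cells f \ (moveHole H T (r, c) (r + 1, c)).1)
      (by rw [filled_moveHole (h.sub h.mem) hpq]; simp),
    subword_cons_of_pos
      (q := fun j => (r, j) ∈ cells f \ (moveHole H T (r, c) (r + 1, c)).1)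
      (by rw [filled_moveHole (h.sub h.mem) hpq]; simp),
    key _ (by simp), key _ hcL, key _ (by simp), key _ hcL, moveHole_apply _ _ hpq, if_pos rfl]
  have hsorted : (T (r + 1, c) ::
      subword (fun j => (r + 1, j) ∈ cells f \ H) (fun j => T (r + 1, j)) L).Pairwise (· ≤ ·) := by
    rw [List.pairwise_cons]
    refine ⟨fun x hx => ?_, subword_pairwise hLp fun a _ b _ ha hb hab =>
      h.row _ _ _ (by simp) ha hb hab⟩
    obtain ⟨a, ha, hqa, rfl⟩ := mem_subword.1 hx
    exact h.row _ _ _ (by simp) hd hqa (hlt a ha)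
  have hleft := fun Z => knuth_bump_left (fun j => T (r, j)) (fun j => T (r + 1, j))
    (fun j => (r, j) ∈ cells f \ H) (fun j => (r + 1, j) ∈ cells f \ H) c Z
    (fun a ha hqa => by
      have hb := h.filled_left_le hf (k := r + 1) hqa.1.2.1 (by omega) ha.le hd
      exact ⟨hb, h.col _ _ _ le_rfl hqa hb (by omega)⟩)
    (fun a b _ ha hb hab => h.row _ _ _ (by simp) ha hb hab)
    (fun a b _ ha hb hab => h.row _ _ _ le_rfl ha hb hab)
  have hle : ∀ a < c, (r + 1, a) ∈ cells f \ H → ∀ z ∈ T (r + 1, c) ::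
      subword (fun j => (r + 1, j) ∈ cells f \ H) (fun j => T (r + 1, j)) L, T (r + 1, a) ≤ z := by
    intro a ha hqa z hz
    have hac := h.row _ _ _ (by simp) hqa hd ha
    rcases List.mem_cons.1 hz with rfl | hz
    · exact hac
    · exact hac.trans ((List.pairwise_cons.1 hsorted).1 z hz)
  have h₁ := hleft _ hsorted hle
  have h₂ := hleft _ (List.pairwise_cons.1 hsorted).2
    fun a ha hqa z hz => hle a ha hqa z (List.mem_cons_of_mem _ hz)
  have hmid := knuth_bump_right (fun j => T (r, j)) (fun j => T (r + 1, j))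
    (fun j => (r, j) ∈ cells f \ H) (fun j => (r + 1, j) ∈ cells f \ H) L [T (r + 1, c)] hLp
    (fun a ha b _ hab hb => h.filled_left_le hf (by have := hlt a ha; omega) (by omega) hab.le hb)
    (fun a ha hqa => by
      have hb := h.filled_above hf hqa (by have := hlt a ha; omega)
      exact ⟨hb, h.col _ _ _ le_rfl hb hqa (by omega)⟩)
    (fun a _ b _ ha hb hab => h.row _ _ _ (by simp) ha hb hab)
    (fun a _ b _ ha hb hab => h.row _ _ _ le_rfl ha hb hab)
    (by simp)
    (by
      intro x hx a ha hqa
      obtain rfl : x = T (r + 1, c) := by simpa using hx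
      have hca := hlt a ha
      have hc1 := h.filled_left_le hf (j := c + 1) (k := r) (by omega) (by omega) hca hqa
      refine (hr hc1).trans ?_
      rcases Nat.eq_or_lt_of_le hca with rfl | hlt'
      · exact le_rfl
      · exact h.row _ _ _ le_rfl hc1 hqa hlt')
  generalize subword (fun j => (r + 1, j) ∈ cells f \ H) (fun j => T (r + 1, j)) (List.range c) = V
    at *
  generalize subword (fun j => (r, j) ∈ cells f \ H) (fun j => T (r, j)) (List.range c) = U at *
  generalize subword (fun j => (r + 1, j) ∈ cells f \ H) (fun j => T (r + 1, j)) L = V' at *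
  generalize subword (fun j => (r, j) ∈ cells f \ H) (fun j => T (r, j)) L = U' at *
  have e₁ := h₁.append_right U'
  have e₂ := hmid.append_left (V ++ U)
  have e₃ := h₂.symm.append_right (T (r + 1, c) :: U')
  simp only [List.append_assoc, List.cons_append, List.nil_append] at e₁ e₂ e₃ ⊢
  exact e₁.trans (e₂.trans e₃)

theorem knuth_moveDown (hf : IsPartitionF f) (h : SlideInv f H T (r, c)) {N M : ℕ}
    (hN : ∀ i, N < i → f i = 0)
    (hM : ∀ k, 1 ≤ k → f k < M) (hd : (r + 1, c) ∈ cells f \ H)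
    (hr : (r, c + 1) ∈ cells f \ H → T (r + 1, c) ≤ T (r, c + 1)) :
    Knuth (rowWordP f H T N)
      (rowWordP f (moveHole H T (r, c) (r + 1, c)).1 (moveHole H T (r, c) (r + 1, c)).2 N) := by
  have h1 : 1 ≤ r := (h.sub h.mem).1
  obtain ⟨k, rfl⟩ := Nat.exists_eq_add_of_le' h1
  have hkN : k + 1 < N := by
    by_contra hlt
    have h0 := hN (k + 1 + 1) (by omega)
    have := hd.1
    simp only [cells, Set.mem_ofPred_eq] at this
    omega
  have hrows := h.knuth_rows_moveDown hf hM hd hr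
  rw [rowWordP_eq f _ _ N M hM, rowWordP_eq f _ _ N M hM]
  obtain ⟨L, hL, -, hlt⟩ := range_eq_append_cons hkN
  have hne : ∀ L' : List ℕ, k ∉ L' → k + 1 ∉ L' →
      L'.map (fun i => rowWord f (moveHole H T (k + 1, c) (k + 1 + 1, c)).1
        (moveHole H T (k + 1, c) (k + 1 + 1, c)).2 M (i + 1)) =
      L'.map (fun i => rowWord f H T M (i + 1)) := by
    intro L' h₁ h₂
    apply List.map_congr_left
    intro i hi
    refine h.rowWord_moveHole_of_ne (by simp) (fun e => h₁ ?_) (fun e => h₂ ?_)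
    · rwa [← Nat.succ_injective e]
    · rwa [← Nat.succ_injective e]
  rw [hL, List.range_succ]
  simp only [List.reverse_append, List.reverse_cons, List.reverse_nil, List.nil_append,
    List.map_append, List.map_cons, List.map_nil, List.flatten_append, List.flatten_cons,
    List.flatten_nil, List.append_nil]
  rw [hne _ (fun hk => by have := hlt _ (List.mem_reverse.1 hk); omega)
      (fun hk => (hlt _ (List.mem_reverse.1 hk)).false),
    hne _ (by simp) (by simp)]
  simpa using hrows.append_append (L.reverse.map (fun i => rowWord f H T M (i + 1))).flatten
    ((List.range k).reverse.map (fun i => rowWord f H T M (i + 1))).flatten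

theorem slideStep (hf : IsPartitionF f) {N : ℕ} (hN : ∀ i, N < i → f i = 0) {p p' : ℕ × ℕ}
    {H' : Set (ℕ × ℕ)} {T' : ℕ × ℕ → ℕ} (h : SlideInv f H T p)
    (hs : SlideStep f (H, T, p) (H', T', p')) :
    SlideInv f H' T' p' ∧ Knuth (rowWordP f H T N) (rowWordP f H' T' N) := by
  obtain ⟨r, c⟩ := p
  have hM : ∀ k, 1 ≤ k → f k < f 1 + 1 := fun k hk =>
    Nat.lt_succ_of_le (hf.1 1 k le_rfl hk)
  rcases hs with ⟨hr, hd, he⟩ | ⟨hd, hr, he⟩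
  all_goals
    simp only [Prod.mk.injEq] at hr hd he
    obtain ⟨rfl, rfl, rfl⟩ := he
  · refine ⟨h.moveRight hf hr hd, ?_⟩
    rw [rowWordP_eq f _ _ N _ hM, rowWordP_eq f _ _ N _ hM]
    simp only [h.rowWord_moveRight hM hr]
    exact Knuth.refl _
  · exact ⟨h.moveDown hd, h.knuth_moveDown hf hN hM hd hr⟩

end SlideInv

theorem stmt8 (f : ℕ → ℕ) (hf : IsPartitionF f) (H : Set (ℕ × ℕ)) (hH : H ⊆ cells f)
    (T : ℕ × ℕ → ℕ) (hT : PSSYT f H T)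
    (p : ℕ × ℕ) (hp : LatestSlidable f H p)
    (H' : Set (ℕ × ℕ)) (T' : ℕ × ℕ → ℕ) (p' : ℕ × ℕ)
    (hslide : Relation.ReflTransGen (SlideStep f) (H, T, p) (H', T', p'))
    (hterm : ¬ Slidable f H' p')
    (N : ℕ) (hN : ∀ i, N < i → f i = 0) :
    Knuth (rowWordP f H T N) (rowWordP f H' T' N) := by
  have hinv : SlideInv f H T p :=
    ⟨hH, hp.1.1, hp.2, fun i j l _ => hT.2.1 i j l, fun i k j _ => hT.2.2 i k j⟩
  suffices hmain : ∀ s, Relation.ReflTransGen (SlideStep f) (H, T, p) s →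
      SlideInv f s.1 s.2.1 s.2.2 ∧ Knuth (rowWordP f H T N) (rowWordP f s.1 s.2.1 N) from
    (hmain _ hslide).2
  intro s hs
  induction hs with
  | refl => exact ⟨hinv, Knuth.refl _⟩
  | tail _ hstep ih =>
    obtain ⟨h₁, h₂⟩ := ih.1.slideStep hf hN hstep
    exact ⟨h₁, ih.2.trans h₂⟩
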